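/- arXiv:2301.08298 — 2 statements merged into one kernel-verified Lean document; each statement's English description precedes it below -/
import Mathlib

section
/- Let x_b = (1/2, √3/6) be the barycentre of the triangle with vertices z₀, z₁, z₂, and let C_sph(x_b) := sup{ μ(B(x_b,d)) / (2d)^s : √3/12 ≤ d ≤ √3/3 }. For k ≥ 3, let C_sph^k(x_b) := max{ μ_k(B(x_b,d)) / (2d)^s : d = |x − x_b| for some x ∈ A_k }, let D_k be a radius attaining this maximum, and set C̲_sph^k(x_b) := μ_k(B(x_b, D_k − 2^{−k})) / (2D_k)^s and C̄_sph^k(x_b) := (1 + 2^{2−k}·√3)^s · C_sph^k(x_b). Then C̲_sph^k(x_b) ≤ C_sph(x_b) ≤ C̄_sph^k(x_b). -/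
open MeasureTheory Metric Set
open scoped ENNReal

noncomputable section

/-- The point `(a, b)` of the Euclidean plane. -/
def pt (a b : ℝ) : EuclideanSpace ℝ (Fin 2) := (WithLp.equiv 2 (Fin 2 → ℝ)).symm ![a, b]

/-- The translation vectors of the three similitudes. -/
def v : Fin 3 → EuclideanSpace ℝ (Fin 2)
  | 0 => pt 0 0
  | 1 => pt (1/2) 0
  | 2 => pt (1/4) (Real.sqrt 3 / 4)

/-- The three similitudes generating the Sierpinski gasket. -/
def f (i : Fin 3) (x : EuclideanSpace ℝ (Fin 2)) : EuclideanSpace ℝ (Fin 2) :=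
  (1/2 : ℝ) • x + v i

/-- `fword [i₁, …, i_k] = f_{i₁} ∘ ⋯ ∘ f_{i_k}`. -/
def fword : List (Fin 3) → EuclideanSpace ℝ (Fin 2) → EuclideanSpace ℝ (Fin 2)
  | [] => id
  | i :: l => f i ∘ fword l

/-- The similarity dimension `s = log 3 / log 2`. -/
def sDim : ℝ := Real.log 3 / Real.log 2

/-- The normalised Hausdorff measure `μ = H^s(S)⁻¹ • H^s⌊S`. -/
def muS (S : Set (EuclideanSpace ℝ (Fin 2))) : Measure (EuclideanSpace ℝ (Fin 2)) :=
  (μH[sDim] S)⁻¹ • (μH[sDim]).restrict S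

/-- Fixed points `z_i = 2 v_i`. -/
def z (i : Fin 3) : EuclideanSpace ℝ (Fin 2) := (2 : ℝ) • v i

/-- The Hutchinson operator. -/
def Fop (A : Set (EuclideanSpace ℝ (Fin 2))) : Set (EuclideanSpace ℝ (Fin 2)) :=
  f 0 '' A ∪ f 1 '' A ∪ f 2 '' A

/-- The discrete approximations `A_k = F^{k-1}(A₁)`, `A₁ = {z₀, z₁, z₂}`. -/
def Aset (k : ℕ) : Set (EuclideanSpace ℝ (Fin 2)) := Fop^[k - 1] {z 0, z 1, z 2}

/-- The discrete measures `μ_k`. -/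
def muk (k : ℕ) : Measure (EuclideanSpace ℝ (Fin 2)) :=
  ((3 : ℝ≥0∞)⁻¹ ^ k) • ∑ i : Fin (k - 1) → Fin 3,
    (Measure.dirac (fword (List.ofFn i) (z 0)) + Measure.dirac (fword (List.ofFn i) (z 1)) +
      Measure.dirac (fword (List.ofFn i) (z 2)))

/-- The centred Hausdorff premeasure `C₀^s(A)` (the limit as `δ → 0⁺` is written as a
supremum over `δ > 0`, the inner infimum being antitone in `δ`). -/
def centredPremeasure (s : ℝ) (A : Set (EuclideanSpace ℝ (Fin 2))) : ℝ≥0∞ :=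
  ⨆ (δ : ℝ) (_ : 0 < δ),
    ⨅ (x : ℕ → EuclideanSpace ℝ (Fin 2)) (d : ℕ → ℝ) (_ : ∀ n, x n ∈ A)
      (_ : ∀ n, 0 ≤ d n) (_ : ∀ n, 2 * d n ≤ δ) (_ : A ⊆ ⋃ n, closedBall (x n) (d n)),
      ∑' n, ENNReal.ofReal ((2 * d n) ^ s)

/-- The reflection across the vertical line `x₁ = 1/2`. -/
def refl2 (x : EuclideanSpace ℝ (Fin 2)) : EuclideanSpace ℝ (Fin 2) := pt (1 - x 0) (x 1)

/-- The reflection across the vertical line `x₁ = 1/4`. -/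
def refl4 (x : EuclideanSpace ℝ (Fin 2)) : EuclideanSpace ℝ (Fin 2) := pt (1/2 - x 0) (x 1)

/-- The barycentre of the triangle with vertices `z₀, z₁, z₂`. -/
def xb : EuclideanSpace ℝ (Fin 2) := pt (1/2) (Real.sqrt 3 / 6)

lemma f_eq_midpoint (i : Fin 3) (x : EuclideanSpace ℝ (Fin 2)) :
    f i x = (1/2 : ℝ) • x + (1/2 : ℝ) • z i := by
  simp [f, z, smul_smul]

lemma f_z (i : Fin 3) : f i (z i) = z i := by
  rw [f_eq_midpoint, ← add_smul]; norm_num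

lemma dist_f (i : Fin 3) (x y : EuclideanSpace ℝ (Fin 2)) :
    dist (f i x) (f i y) = 2⁻¹ * dist x y := by
  simp [f, dist_smul₀]

lemma dist_fword (l : List (Fin 3)) (x y : EuclideanSpace ℝ (Fin 2)) :
    dist (fword l x) (fword l y) = 2⁻¹ ^ l.length * dist x y := by
  induction l with
  | nil => simp [fword]
  | cons i l ih => simp only [fword, Function.comp_apply, dist_f, ih, List.length_cons]; ring

lemma mem_Fop {A : Set (EuclideanSpace ℝ (Fin 2))} {x : EuclideanSpace ℝ (Fin 2)} :
    x ∈ Fop A ↔ ∃ i, ∃ y ∈ A, f i y = x := by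
  simp [Fop, Fin.exists_fin_succ, or_assoc]

lemma mem_iterate_Fop (n : ℕ) {A : Set (EuclideanSpace ℝ (Fin 2))}
    {x : EuclideanSpace ℝ (Fin 2)} :
    x ∈ Fop^[n] A ↔ ∃ i : Fin n → Fin 3, ∃ y ∈ A, fword (List.ofFn i) y = x := by
  induction n generalizing x with
  | zero => simp [fword]
  | succ n ih =>
    rw [Function.iterate_succ_apply', mem_Fop, Fin.exists_fin_succ_pi]
    simp only [ih, List.ofFn_cons, fword, Function.comp_apply]
    constructor
    · rintro ⟨i, -, ⟨t, y, hy, rfl⟩, rfl⟩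
      exact ⟨i, t, y, hy, rfl⟩
    · rintro ⟨i, t, y, hy, rfl⟩
      exact ⟨i, _, ⟨t, y, hy, rfl⟩, rfl⟩

/-- The similitude attached to a word of length `n + 1`, given by its first `n` letters and its
last letter. -/
def cellMap (n : ℕ) (w : (Fin n → Fin 3) × Fin 3) (x : EuclideanSpace ℝ (Fin 2)) :
    EuclideanSpace ℝ (Fin 2) :=
  fword (List.ofFn w.1) (f w.2 x)

/-- The vertex of a cell fixed by the last letter of its word. -/
def cellVertex (n : ℕ) (w : (Fin n → Fin 3) × Fin 3) : EuclideanSpace ℝ (Fin 2) :=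
  fword (List.ofFn w.1) (z w.2)

lemma cellMap_z (n : ℕ) (w : (Fin n → Fin 3) × Fin 3) :
    cellMap n w (z w.2) = cellVertex n w := by
  simp [cellMap, cellVertex, f_z]

lemma dist_cellMap (n : ℕ) (w : (Fin n → Fin 3) × Fin 3) (x y : EuclideanSpace ℝ (Fin 2)) :
    dist (cellMap n w x) (cellMap n w y) = 2⁻¹ ^ (n + 1) * dist x y := by
  rw [cellMap, cellMap, dist_fword, dist_f, List.length_ofFn]; ring

lemma Aset_succ (n : ℕ) : Aset (n + 1) = range (cellVertex n) := by
  ext x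
  simp only [Aset, Nat.add_sub_cancel, mem_iterate_Fop, mem_range, Prod.exists, cellVertex]
  refine exists_congr fun i => ?_
  simp [Fin.exists_fin_succ]

lemma iUnion_cellMap_image {S : Set (EuclideanSpace ℝ (Fin 2))}
    (hS : S = f 0 '' S ∪ f 1 '' S ∪ f 2 '' S) (n : ℕ) : ⋃ w, cellMap n w '' S = S := by
  have hF : Fop S = S := hS.symm
  have hn : Fop^[n] S = S := Function.iterate_fixed hF n
  ext x
  conv_rhs => rw [← hn, mem_iterate_Fop]
  simp only [mem_iUnion, mem_image, Prod.exists, cellMap]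
  refine exists_congr fun i => ⟨?_, ?_⟩
  · rintro ⟨j, y, hy, rfl⟩
    exact ⟨f j y, hF ▸ mem_Fop.2 ⟨j, y, hy, rfl⟩, rfl⟩
  · rintro ⟨y, hy, rfl⟩
    rw [← hF, mem_Fop] at hy
    obtain ⟨j, y, hy, rfl⟩ := hy
    exact ⟨j, y, hy, rfl⟩

lemma ConvexOn.map_f_le {g : EuclideanSpace ℝ (Fin 2) → ℝ} (hg : ConvexOn ℝ univ g) (i : Fin 3)
    (x : EuclideanSpace ℝ (Fin 2)) : g (f i x) ≤ (g x + g (z i)) / 2 := by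
  have := hg.2 (mem_univ x) (mem_univ (z i)) (by norm_num : (0 : ℝ) ≤ 1/2)
    (by norm_num : (0 : ℝ) ≤ 1/2) (by norm_num)
  rw [← f_eq_midpoint, smul_eq_mul, smul_eq_mul] at this
  linarith

/-- A maximum principle on the attractor. -/
lemma ConvexOn.le_of_mem_attractor {S : Set (EuclideanSpace ℝ (Fin 2))} (hScomp : IsCompact S)
    (hS : S = f 0 '' S ∪ f 1 '' S ∪ f 2 '' S) {g : EuclideanSpace ℝ (Fin 2) → ℝ}
    (hg : ConvexOn ℝ univ g) (hgc : Continuous g) {M : ℝ} (hM : ∀ i, g (z i) ≤ M)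
    {x : EuclideanSpace ℝ (Fin 2)} (hx : x ∈ S) : g x ≤ M := by
  obtain ⟨m, hm, hmax⟩ := hScomp.exists_isMaxOn ⟨x, hx⟩ hgc.continuousOn
  have hF : Fop S = S := hS.symm
  obtain ⟨i, y, hy, rfl⟩ := mem_Fop.1 (hF.symm ▸ hm)
  have h₁ := hg.map_f_le i y
  have h₂ : g y ≤ g (f i y) := hmax hy
  have h₃ : g x ≤ g (f i y) := hmax hx
  linarith [hM i]

lemma ConvexOn.le_of_mem_Aset {g : EuclideanSpace ℝ (Fin 2) → ℝ} (hg : ConvexOn ℝ univ g)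
    {M : ℝ} (hM : ∀ i, g (z i) ≤ M) (k : ℕ) {x : EuclideanSpace ℝ (Fin 2)} (hx : x ∈ Aset k) :
    g x ≤ M := by
  unfold Aset at hx
  generalize k - 1 = n at hx
  induction n generalizing x with
  | zero =>
    simp only [Function.iterate_zero, id_eq, mem_insert_iff, mem_singleton_iff] at hx
    rcases hx with rfl | rfl | rfl <;> exact hM _
  | succ n ih =>
    rw [Function.iterate_succ_apply', mem_Fop] at hx
    obtain ⟨i, y, hy, rfl⟩ := hx
    linarith [hg.map_f_le i y, ih hy, hM i]

lemma dist_z_le_one (i j : Fin 3) : dist (z i) (z j) ≤ 1 := by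
  have h3 : √3 ^ 2 = (3 : ℝ) := Real.sq_sqrt (by norm_num)
  rw [EuclideanSpace.dist_eq, Real.sqrt_le_one]
  fin_cases i <;> fin_cases j <;>
    simp [z, v, pt, Fin.sum_univ_two, Real.dist_eq, sq_abs] <;> nlinarith

lemma dist_z_xb (i : Fin 3) : dist (z i) xb = √3 / 3 := by
  have h3 : √3 ^ 2 = (3 : ℝ) := Real.sq_sqrt (by norm_num)
  rw [EuclideanSpace.dist_eq, Real.sqrt_eq_iff_eq_sq (by positivity) (by positivity)]
  fin_cases i <;>
    simp [z, v, pt, xb, Fin.sum_univ_two, Real.dist_eq, sq_abs] <;> nlinarith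

lemma inner_f_z_sub_xb (i j : Fin 3) :
    1 / 12 ≤ inner ℝ (z i - xb) (f i (z j) - xb) := by
  have h3 : √3 ^ 2 = (3 : ℝ) := Real.sq_sqrt (by norm_num)
  fin_cases i <;> fin_cases j <;>
    simp [z, f, v, pt, xb, Fin.sum_univ_two, PiLp.inner_apply] <;> nlinarith

lemma dist_xb_le_of_mem_Aset (k : ℕ) {x : EuclideanSpace ℝ (Fin 2)} (hx : x ∈ Aset k) :
    dist x xb ≤ √3 / 3 :=
  (convexOn_univ_dist xb).le_of_mem_Aset (fun i => (dist_z_xb i).le) k hx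

lemma le_dist_xb_of_mem_Aset {k : ℕ} (hk : 2 ≤ k) {x : EuclideanSpace ℝ (Fin 2)}
    (hx : x ∈ Aset k) : √3 / 12 ≤ dist x xb := by
  obtain ⟨m, rfl⟩ := Nat.exists_eq_add_of_le' hk
  have hx' : x ∈ Fop (Aset (m + 1)) := by
    simpa only [Aset, Nat.add_sub_cancel, Nat.reduceSubDiff, Function.iterate_succ_apply'] using hx
  obtain ⟨i, y, hy, rfl⟩ := mem_Fop.1 hx'
  have hconv : ConvexOn ℝ univ fun y => -inner ℝ (z i - xb) (f i y - xb) := by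
    refine ⟨convex_univ, fun a _ b _ s t _ _ hst => le_of_eq ?_⟩
    obtain rfl : t = 1 - s := by linarith
    simp only [f, inner_sub_right, inner_add_right, inner_smul_right, smul_eq_mul]
    ring
  have h := hconv.le_of_mem_Aset (M := -(1 / 12))
    (fun j => neg_le_neg (inner_f_z_sub_xb i j)) _ hy
  have h₂ := real_inner_le_norm (z i - xb) (f i y - xb)
  rw [← dist_eq_norm, ← dist_eq_norm, dist_z_xb] at h₂
  have h3 : √3 ^ 2 = (3 : ℝ) := Real.sq_sqrt (by norm_num)
  have h0 : 0 < √3 := by positivity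
  nlinarith

lemma sDim_pos : 0 < sDim := div_pos (Real.log_pos (by norm_num)) (Real.log_pos (by norm_num))

lemma two_rpow_sDim : (2 : ℝ) ^ sDim = 3 := by
  rw [sDim, ← Real.logb, Real.rpow_logb] <;> norm_num

lemma muS_cellMap_image_le {S : Set (EuclideanSpace ℝ (Fin 2))} (hSpos : 0 < μH[sDim] S)
    (hSfin : μH[sDim] S < ⊤) (n : ℕ) (w : (Fin n → Fin 3) × Fin 3) :
    muS S (cellMap n w '' S) ≤ 3⁻¹ ^ (n + 1) := by
  have hL : LipschitzWith (2⁻¹ ^ (n + 1)) (cellMap n w) :=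
    LipschitzWith.of_dist_le_mul fun x y => by simp [dist_cellMap]
  have hc : ((2⁻¹ ^ (n + 1) : NNReal) : ℝ≥0∞) ^ sDim = 3⁻¹ ^ (n + 1) := by
    have h2 : (2 : ℝ≥0∞) ^ sDim = 3 := by
      rw [← ENNReal.ofReal_ofNat 2, ENNReal.ofReal_rpow_of_pos two_pos, two_rpow_sDim,
        ENNReal.ofReal_ofNat]
    rw [ENNReal.coe_pow, ENNReal.coe_inv two_ne_zero, ENNReal.coe_ofNat, ← ENNReal.rpow_natCast,
      ← ENNReal.rpow_mul, mul_comm, ENNReal.rpow_mul, ENNReal.inv_rpow, h2, ENNReal.rpow_natCast]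
  have h := hL.lipschitzOnWith (s := S) |>.hausdorffMeasure_image_le sDim_pos.le
  rw [hc] at h
  calc muS S (cellMap n w '' S) ≤ (μH[sDim] S)⁻¹ * μH[sDim] (cellMap n w '' S) := by
        rw [muS, Measure.smul_apply, smul_eq_mul]
        exact mul_le_mul_right (Measure.restrict_apply_le _ _) _
    _ ≤ (μH[sDim] S)⁻¹ * (3⁻¹ ^ (n + 1) * μH[sDim] S) := by gcongr
    _ = 3⁻¹ ^ (n + 1) := by
        rw [mul_left_comm, ENNReal.inv_mul_cancel hSpos.ne' hSfin.ne, mul_one]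

lemma muS_self {S : Set (EuclideanSpace ℝ (Fin 2))} (hSpos : 0 < μH[sDim] S)
    (hSfin : μH[sDim] S < ⊤) : muS S S = 1 := by
  rw [muS, Measure.smul_apply, Measure.restrict_apply_self, smul_eq_mul,
    ENNReal.inv_mul_cancel hSpos.ne' hSfin.ne]

lemma muS_biUnion_le {S : Set (EuclideanSpace ℝ (Fin 2))} (hSpos : 0 < μH[sDim] S)
    (hSfin : μH[sDim] S < ⊤) (n : ℕ) (W : Finset ((Fin n → Fin 3) × Fin 3)) :
    muS S (⋃ w ∈ W, cellMap n w '' S) ≤ 3⁻¹ ^ (n + 1) * W.card := by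
  refine (measure_biUnion_finset_le W _).trans ?_
  refine (Finset.sum_le_card_nsmul W _ _ fun w _ => muS_cellMap_image_le hSpos hSfin n w).trans ?_
  rw [nsmul_eq_mul, mul_comm]

open Classical in
lemma muk_succ_apply (n : ℕ) {B : Set (EuclideanSpace ℝ (Fin 2))} (hB : MeasurableSet B) :
    muk (n + 1) B = 3⁻¹ ^ (n + 1) * (Finset.univ.filter fun w => cellVertex n w ∈ B).card := by
  have hcard : ((Finset.univ.filter fun w => cellVertex n w ∈ B).card : ℝ≥0∞) =
      ∑ w, B.indicator 1 (cellVertex n w) := by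
    rw [Finset.card_filter, Nat.cast_sum]
    simp [indicator_apply, -Finset.sum_boole]
  rw [hcard, Fintype.sum_prod_type]
  simp only [muk, Nat.add_sub_cancel, Measure.smul_apply, Measure.finsetSum_apply,
    Measure.add_apply, Measure.dirac_apply' _ hB, smul_eq_mul, cellVertex, Fin.sum_univ_three]
  rfl

lemma dist_cellMap_cellVertex_le {S : Set (EuclideanSpace ℝ (Fin 2))} (hScomp : IsCompact S)
    (hS : S = f 0 '' S ∪ f 1 '' S ∪ f 2 '' S) (n : ℕ) (w : (Fin n → Fin 3) × Fin 3)
    {x : EuclideanSpace ℝ (Fin 2)} (hx : x ∈ S) :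
    dist (cellMap n w x) (cellVertex n w) ≤ 2⁻¹ ^ (n + 1) := by
  rw [← cellMap_z, dist_cellMap]
  refine mul_le_of_le_one_right (by positivity) ?_
  exact (convexOn_univ_dist (z w.2)).le_of_mem_attractor hScomp hS (by fun_prop)
    (fun i => dist_z_le_one i _) hx

open Classical in
lemma muk_closedBall_sub_le {S : Set (EuclideanSpace ℝ (Fin 2))} (hScomp : IsCompact S)
    (hS : S = f 0 '' S ∪ f 1 '' S ∪ f 2 '' S) (hSpos : 0 < μH[sDim] S) (hSfin : μH[sDim] S < ⊤)
    (n : ℕ) (c : EuclideanSpace ℝ (Fin 2)) (r : ℝ) :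
    muk (n + 1) (closedBall c (r - 2⁻¹ ^ (n + 1))) ≤ muS S (closedBall c r) := by
  rw [muk_succ_apply n measurableSet_closedBall]
  generalize hWdef : (Finset.univ.filter fun w => cellVertex n w ∈
    closedBall c (r - 2⁻¹ ^ (n + 1))) = W
  have hW : ⋃ w ∈ W, cellMap n w '' S ⊆ closedBall c r := by
    simp only [iUnion_subset_iff, image_subset_iff]
    intro w hw x hx
    rw [← hWdef, Finset.mem_filter] at hw
    have h₁ := mem_closedBall.1 hw.2
    have h₂ := dist_cellMap_cellVertex_le hScomp hS n w hx
    rw [mem_preimage, mem_closedBall]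
    linarith [dist_triangle (cellMap n w x) (cellVertex n w) c]
  have hcov : S ⊆ (⋃ w ∈ W, cellMap n w '' S) ∪ ⋃ w ∈ Wᶜ, cellMap n w '' S := by
    conv_lhs => rw [← iUnion_cellMap_image hS n]
    refine iUnion_subset fun w => ?_
    by_cases hw : w ∈ W
    · exact (subset_biUnion_of_mem (u := fun w => cellMap n w '' S) hw).trans subset_union_left
    · exact (subset_biUnion_of_mem (u := fun w => cellMap n w '' S)
        (Finset.mem_compl.2 hw)).trans subset_union_right
  have htotal : (3⁻¹ : ℝ≥0∞) ^ (n + 1) * W.card + 3⁻¹ ^ (n + 1) * Wᶜ.card = 1 := by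
    rw [← mul_add, ← Nat.cast_add, Finset.card_add_card_compl, Fintype.card_prod,
      Fintype.card_fun, Fintype.card_fin, Fintype.card_fin, ← pow_succ, Nat.cast_pow, ← mul_pow,
      Nat.cast_ofNat, ENNReal.inv_mul_cancel (by norm_num) (by norm_num), one_pow]
  have hfin : (3⁻¹ : ℝ≥0∞) ^ (n + 1) * Wᶜ.card ≠ ⊤ :=
    ne_top_of_le_ne_top ENNReal.one_ne_top (htotal ▸ le_add_self)
  refine (ENNReal.add_le_add_iff_right hfin).1 ?_
  calc _ = muS S S := by rw [htotal, muS_self hSpos hSfin]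
    _ ≤ muS S (⋃ w ∈ W, cellMap n w '' S) + muS S (⋃ w ∈ Wᶜ, cellMap n w '' S) :=
      (measure_mono hcov).trans (measure_union_le _ _)
    _ ≤ _ := add_le_add (measure_mono hW) (muS_biUnion_le hSpos hSfin n Wᶜ)

open Classical in
lemma muS_closedBall_le {S : Set (EuclideanSpace ℝ (Fin 2))} (hScomp : IsCompact S)
    (hS : S = f 0 '' S ∪ f 1 '' S ∪ f 2 '' S) (hSpos : 0 < μH[sDim] S) (hSfin : μH[sDim] S < ⊤)
    (n : ℕ) (c : EuclideanSpace ℝ (Fin 2)) (r : ℝ) :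
    muS S (closedBall c r) ≤ muk (n + 1) (closedBall c (r + 2⁻¹ ^ (n + 1))) := by
  rw [muk_succ_apply n measurableSet_closedBall]
  refine le_trans ?_ (muS_biUnion_le hSpos hSfin n _)
  have hinter : muS S (closedBall c r) = muS S (closedBall c r ∩ S) := by
    simp only [muS, Measure.smul_apply, Measure.restrict_apply measurableSet_closedBall,
      Measure.restrict_apply (measurableSet_closedBall.inter hScomp.measurableSet), inter_assoc,
      inter_self]
  rw [hinter]
  refine measure_mono ?_
  rintro y ⟨hyc, hyS⟩
  rw [← iUnion_cellMap_image hS n, mem_iUnion] at hyS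
  obtain ⟨w, x, hx, rfl⟩ := hyS
  refine mem_iUnion₂.2 ⟨w, Finset.mem_filter.2 ⟨Finset.mem_univ _, ?_⟩, x, hx, rfl⟩
  have h₂ := dist_cellMap_cellVertex_le hScomp hS n w hx
  rw [dist_comm] at h₂
  have h₁ := mem_closedBall.1 hyc
  exact mem_closedBall.2 (by linarith [dist_triangle (cellVertex n w) (cellMap n w x) c])

/-- A ball carries the same `μ_k`-mass as the smaller concentric ball whose boundary meets `A_k`,
so a density bound on balls through points of `A_k` extends to all balls. -/
lemma muk_closedBall_le_of_forall_mem_Aset (n : ℕ) {c : EuclideanSpace ℝ (Fin 2)} {C : ℝ≥0∞}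
    (hpos : ∀ x ∈ Aset (n + 1), 0 < dist x c)
    (hC : ∀ x ∈ Aset (n + 1),
      muk (n + 1) (closedBall c (dist x c)) / ENNReal.ofReal ((2 * dist x c) ^ sDim) ≤ C) (r : ℝ) :
    muk (n + 1) (closedBall c r) ≤ C * ENNReal.ofReal ((2 * r) ^ sDim) := by
  classical
  set W := Finset.univ.filter fun w => cellVertex n w ∈ closedBall c r with hWdef
  have hmeas := muk_succ_apply n (measurableSet_closedBall (x := c) (ε := r))
  rw [← hWdef] at hmeas
  rcases W.eq_empty_or_nonempty with hW | hW
  · simp [hmeas, hW]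
  obtain ⟨w, hwW, hw⟩ := W.exists_max_image (fun w => dist (cellVertex n w) c) hW
  have hmem : cellVertex n w ∈ Aset (n + 1) := Aset_succ n ▸ mem_range_self w
  have hwr : dist (cellVertex n w) c ≤ r := (Finset.mem_filter.1 hwW).2
  have hle : muk (n + 1) (closedBall c r) ≤
      muk (n + 1) (closedBall c (dist (cellVertex n w) c)) := by
    rw [hmeas, muk_succ_apply n measurableSet_closedBall]
    gcongr
    exact fun u hu => Finset.mem_filter.2 ⟨Finset.mem_univ _, hw u hu⟩
  have h₀ := hpos _ hmem
  have hpow : 0 < (2 * dist (cellVertex n w) c) ^ sDim := by positivity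
  refine hle.trans <| ((ENNReal.div_le_iff (ENNReal.ofReal_pos.2 hpow).ne'
    ENNReal.ofReal_ne_top).1 (hC _ hmem)).trans ?_
  gcongr
  exact sDim_pos.le

theorem statement17 (S : Set (EuclideanSpace ℝ (Fin 2))) (hScomp : IsCompact S) (hSne : S.Nonempty)
    (hSinv : S = f 0 '' S ∪ f 1 '' S ∪ f 2 '' S)
    (hSpos : 0 < μH[sDim] S) (hSfin : μH[sDim] S < ⊤)
    (k : ℕ) (hk : 3 ≤ k) (x' : EuclideanSpace ℝ (Fin 2)) (Dk : ℝ)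
    (hx' : x' ∈ Aset k) (hDk : Dk = dist x' xb)
    (hmax : ∀ x ∈ Aset k,
      muk k (closedBall xb (dist x xb)) / ENNReal.ofReal ((2 * dist x xb) ^ sDim) ≤
        muk k (closedBall xb Dk) / ENNReal.ofReal ((2 * Dk) ^ sDim)) :
    muk k (closedBall xb (Dk - (2 : ℝ) ^ (-(k : ℤ)))) / ENNReal.ofReal ((2 * Dk) ^ sDim) ≤
        (⨆ (d : ℝ) (_ : d ∈ Icc (Real.sqrt 3 / 12) (Real.sqrt 3 / 3)),
          muS S (closedBall xb d) / ENNReal.ofReal ((2 * d) ^ sDim)) ∧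
      (⨆ (d : ℝ) (_ : d ∈ Icc (Real.sqrt 3 / 12) (Real.sqrt 3 / 3)),
          muS S (closedBall xb d) / ENNReal.ofReal ((2 * d) ^ sDim)) ≤
        ENNReal.ofReal ((1 + (2 : ℝ) ^ ((2 : ℤ) - k) * Real.sqrt 3) ^ sDim) *
          (muk k (closedBall xb Dk) / ENNReal.ofReal ((2 * Dk) ^ sDim)) := by
  obtain ⟨n, rfl⟩ : ∃ n, k = n + 1 := ⟨k - 1, by omega⟩
  have hε : (2 : ℝ) ^ (-((n + 1 : ℕ) : ℤ)) = 2⁻¹ ^ (n + 1) := by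
    rw [zpow_neg, zpow_natCast, inv_pow]
  have hε' : (2 : ℝ) ^ ((2 : ℤ) - (n + 1 : ℕ)) = 4 * 2⁻¹ ^ (n + 1) := by
    rw [sub_eq_add_neg, zpow_add₀ two_ne_zero, hε]
    norm_num
  rw [hε, hε']
  constructor
  · have hmem : Dk ∈ Icc (√3 / 12) (√3 / 3) :=
      hDk ▸ ⟨le_dist_xb_of_mem_Aset (by omega) hx', dist_xb_le_of_mem_Aset _ hx'⟩
    refine le_trans ?_ (le_iSup₂ Dk hmem)
    exact ENNReal.div_le_div_right (muk_closedBall_sub_le hScomp hSinv hSpos hSfin n xb Dk) _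
  · refine iSup₂_le fun d hd => ?_
    have h3 : 0 < √3 := by positivity
    have hd₀ : 0 < d := lt_of_lt_of_le (by positivity) hd.1
    have hpow : 0 < (2 * d) ^ sDim := by positivity
    set C := muk (n + 1) (closedBall xb Dk) / ENNReal.ofReal ((2 * Dk) ^ sDim)
    have hpos : ∀ x ∈ Aset (n + 1), 0 < dist x xb := fun x hx =>
      lt_of_lt_of_le (by positivity) (le_dist_xb_of_mem_Aset (by omega) hx)
    have hrad : 2 * (d + 2⁻¹ ^ (n + 1)) ≤ (1 + 4 * 2⁻¹ ^ (n + 1) * √3) * (2 * d) := by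
      have hsq : √3 ^ 2 = (3 : ℝ) := Real.sq_sqrt (by norm_num)
      have hone : 1 ≤ 4 * √3 * d := by nlinarith [hd.1]
      have hq : (0 : ℝ) < 2⁻¹ ^ (n + 1) := by positivity
      nlinarith
    rw [ENNReal.div_le_iff (ENNReal.ofReal_pos.2 hpow).ne' ENNReal.ofReal_ne_top]
    calc muS S (closedBall xb d) ≤ muk (n + 1) (closedBall xb (d + 2⁻¹ ^ (n + 1))) :=
          muS_closedBall_le hScomp hSinv hSpos hSfin n xb d
      _ ≤ C * ENNReal.ofReal ((2 * (d + 2⁻¹ ^ (n + 1))) ^ sDim) :=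
          muk_closedBall_le_of_forall_mem_Aset n hpos hmax _
      _ ≤ C * ENNReal.ofReal (((1 + 4 * 2⁻¹ ^ (n + 1) * √3) * (2 * d)) ^ sDim) := by
          gcongr
          exact sDim_pos.le
      _ = _ := by
          rw [Real.mul_rpow (by positivity) (by positivity),
            ENNReal.ofReal_mul (by positivity)]
          ring

end
end

section
/- For every x ∈ S₀₀ = f₀(f₀(S)), every d > 0, and π₄(x₁,x₂) := (1/2 − x₁, x₂) the reflection across the line x₁ = 1/4, one has the inclusion B(x,d) ∩ (S₁ ∪ S₂) ⊆ B(π₄(x), d) ∩ (S₁ ∪ S₂), and μ(B(x,d) ∩ S₀) = μ(B(π₄(x),d) ∩ S₀). -/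
open MeasureTheory Metric Set
open scoped ENNReal

noncomputable section

@[simp] lemma pt_zero (a b : ℝ) : pt a b 0 = a := rfl

@[simp] lemma pt_one (a b : ℝ) : pt a b 1 = b := rfl

lemma plane_ext {p q : EuclideanSpace ℝ (Fin 2)} (h0 : p 0 = q 0) (h1 : p 1 = q 1) : p = q := by
  ext i
  fin_cases i
  · exact h0
  · exact h1

lemma plane_dist (p q : EuclideanSpace ℝ (Fin 2)) :
    dist p q = Real.sqrt ((p 0 - q 0) ^ 2 + (p 1 - q 1) ^ 2) := by
  simp [EuclideanSpace.dist_eq, Fin.sum_univ_two, Real.dist_eq, sq_abs]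

lemma f_apply (i : Fin 3) (p : EuclideanSpace ℝ (Fin 2)) (j : Fin 2) :
    f i p j = p j / 2 + v i j := by
  simp [f]
  ring

lemma dist_f_s19 (i : Fin 3) (p q : EuclideanSpace ℝ (Fin 2)) :
    dist (f i p) (f i q) = dist p q / 2 := by
  rw [f, f, dist_add_right, dist_smul₀, Real.norm_of_nonneg (by norm_num)]
  ring

lemma continuous_f (i : Fin 3) : Continuous (f i) := by
  unfold f
  fun_prop

lemma refl2_f_zero (p : EuclideanSpace ℝ (Fin 2)) : refl2 (f 0 p) = f 1 (refl2 p) := by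
  apply plane_ext <;> simp [refl2, f_apply, v] <;> ring

lemma refl2_f_one (p : EuclideanSpace ℝ (Fin 2)) : refl2 (f 1 p) = f 0 (refl2 p) := by
  apply plane_ext <;> simp [refl2, f_apply, v] <;> ring

lemma refl2_f_two (p : EuclideanSpace ℝ (Fin 2)) : refl2 (f 2 p) = f 2 (refl2 p) := by
  apply plane_ext <;> simp [refl2, f_apply, v] <;> ring

lemma refl4_f_zero (p : EuclideanSpace ℝ (Fin 2)) : refl4 (f 0 p) = f 0 (refl2 p) := by
  apply plane_ext <;> simp [refl2, refl4, f_apply, v] <;> ring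

lemma refl2_involutive : Function.Involutive refl2 := fun p => by
  apply plane_ext <;> simp [refl2]

lemma refl4_involutive : Function.Involutive refl4 := fun p => by
  apply plane_ext <;> simp [refl4]

lemma isometry_refl2 : Isometry refl2 := Isometry.of_dist_eq fun p q => by
  rw [plane_dist, plane_dist]
  congr 1
  simp only [refl2, pt_zero, pt_one]
  ring

lemma isometry_refl4 : Isometry refl4 := Isometry.of_dist_eq fun p q => by
  rw [plane_dist, plane_dist]
  congr 1
  simp only [refl4, pt_zero, pt_one]
  ring

lemma f_mem {S : Set (EuclideanSpace ℝ (Fin 2))} (hS : S = f 0 '' S ∪ f 1 '' S ∪ f 2 '' S)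
    (i : Fin 3) {p : EuclideanSpace ℝ (Fin 2)} (hp : p ∈ S) : f i p ∈ S := by
  rw [hS]
  fin_cases i
  · exact Or.inl (Or.inl ⟨p, hp, rfl⟩)
  · exact Or.inl (Or.inr ⟨p, hp, rfl⟩)
  · exact Or.inr ⟨p, hp, rfl⟩

lemma exists_eq_f {S : Set (EuclideanSpace ℝ (Fin 2))}
    (hS : S = f 0 '' S ∪ f 1 '' S ∪ f 2 '' S) {p : EuclideanSpace ℝ (Fin 2)} (hp : p ∈ S) :
    ∃ i, ∃ q ∈ S, f i q = p := by
  rw [hS] at hp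
  rcases hp with (⟨q, hq, h⟩ | ⟨q, hq, h⟩) | ⟨q, hq, h⟩
  · exact ⟨0, q, hq, h⟩
  · exact ⟨1, q, hq, h⟩
  · exact ⟨2, q, hq, h⟩

/-- A compact set covered by its images under the similitudes lies in every nonempty closed set
that they preserve. -/
lemma subset_of_invariant {S T : Set (EuclideanSpace ℝ (Fin 2))} (hT : IsCompact T)
    (hTcover : ∀ p ∈ T, ∃ i, ∃ q ∈ T, f i q = p) (hS : IsClosed S) (hSne : S.Nonempty)
    (hSf : ∀ i, ∀ p ∈ S, f i p ∈ S) : T ⊆ S := by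
  intro t ht
  obtain ⟨m, hm, hmax⟩ := hT.exists_isMaxOn ⟨t, ht⟩ (continuous_infDist_pt S).continuousOn
  obtain ⟨i, q, hq, rfl⟩ := hTcover m hm
  have hle : infDist (f i q) S ≤ infDist q S / 2 := by
    have : 2 * infDist (f i q) S ≤ infDist q S := by
      refine (le_infDist hSne).2 fun p hp => ?_
      have := infDist_le_dist_of_mem (x := f i q) (hSf i p hp)
      rw [dist_f_s19] at this
      linarith
    linarith
  have h1 : infDist q S ≤ infDist (f i q) S := hmax hq
  have h2 : infDist t S ≤ infDist (f i q) S := hmax ht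
  have h3 : 0 ≤ infDist t S := infDist_nonneg
  exact (hS.mem_iff_infDist_zero hSne).2 (by linarith)

lemma refl2_mem {S : Set (EuclideanSpace ℝ (Fin 2))} (hSc : IsCompact S)
    (hS : S = f 0 '' S ∪ f 1 '' S ∪ f 2 '' S) {p : EuclideanSpace ℝ (Fin 2)} (hp : p ∈ S) :
    refl2 p ∈ S := by
  refine subset_of_invariant (hSc.image isometry_refl2.continuous) ?_ hSc.isClosed ⟨p, hp⟩
    (fun i q hq => f_mem hS i hq) (mem_image_of_mem refl2 hp)
  rintro _ ⟨r, hr, rfl⟩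
  obtain ⟨i, q, hq, rfl⟩ := exists_eq_f hS hr
  fin_cases i
  · exact ⟨1, _, mem_image_of_mem _ hq, (refl2_f_zero q).symm⟩
  · exact ⟨0, _, mem_image_of_mem _ hq, (refl2_f_one q).symm⟩
  · exact ⟨2, _, mem_image_of_mem _ hq, (refl2_f_two q).symm⟩

lemma nonneg_of_mem {S : Set (EuclideanSpace ℝ (Fin 2))} (hSc : IsCompact S)
    (hS : S = f 0 '' S ∪ f 1 '' S ∪ f 2 '' S) {p : EuclideanSpace ℝ (Fin 2)} (hp : p ∈ S) :
    0 ≤ p 0 := by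
  obtain ⟨m, hm, hmin⟩ := hSc.exists_isMinOn ⟨p, hp⟩
    (f := fun q : EuclideanSpace ℝ (Fin 2) => q 0) (by fun_prop)
  obtain ⟨i, q, hq, rfl⟩ := exists_eq_f hS hm
  have h1 : f i q 0 ≤ q 0 := hmin hq
  have h2 : f i q 0 ≤ p 0 := hmin hp
  have h3 : 0 ≤ v i 0 := by fin_cases i <;> simp [v]
  rw [f_apply] at h1 h2
  linarith

lemma le_one_of_mem {S : Set (EuclideanSpace ℝ (Fin 2))} (hSc : IsCompact S)
    (hS : S = f 0 '' S ∪ f 1 '' S ∪ f 2 '' S) {p : EuclideanSpace ℝ (Fin 2)} (hp : p ∈ S) :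
    p 0 ≤ 1 := by
  have := nonneg_of_mem hSc hS (refl2_mem hSc hS hp)
  simp only [refl2, pt_zero] at this
  linarith

lemma refl4_preimage_f_zero_image {S : Set (EuclideanSpace ℝ (Fin 2))} (hSc : IsCompact S)
    (hS : S = f 0 '' S ∪ f 1 '' S ∪ f 2 '' S) : refl4 ⁻¹' (f 0 '' S) = f 0 '' S := by
  have h : ∀ p ∈ f 0 '' S, refl4 p ∈ f 0 '' S := by
    rintro _ ⟨q, hq, rfl⟩
    exact ⟨refl2 q, refl2_mem hSc hS hq, (refl4_f_zero q).symm⟩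
  exact Subset.antisymm (fun p hp => by simpa only [refl4_involutive p] using h _ hp) h

/-- Reflecting a point from the left of the line `x₁ = 1/4` brings it closer to the points on
the right. -/
lemma dist_refl4_le {p q : EuclideanSpace ℝ (Fin 2)} (hp : p 0 ≤ 1 / 4) (hq : 1 / 4 ≤ q 0) :
    dist q (refl4 p) ≤ dist q p := by
  rw [plane_dist, plane_dist]
  apply Real.sqrt_le_sqrt
  simp only [refl4, pt_zero, pt_one]
  nlinarith [mul_nonneg (sub_nonneg.2 hp) (sub_nonneg.2 hq)]

lemma muS_apply_of_subset {S A : Set (EuclideanSpace ℝ (Fin 2))} (hA : MeasurableSet A)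
    (hAS : A ⊆ S) : muS S A = (μH[sDim] S)⁻¹ * μH[sDim] A := by
  rw [muS, Measure.smul_apply, Measure.restrict_apply hA, inter_eq_left.2 hAS, smul_eq_mul]

theorem statement19 (S : Set (EuclideanSpace ℝ (Fin 2))) (hScomp : IsCompact S) (hSne : S.Nonempty)
    (hSinv : S = f 0 '' S ∪ f 1 '' S ∪ f 2 '' S)
    (hSpos : 0 < μH[sDim] S) (hSfin : μH[sDim] S < ⊤)
    (x : EuclideanSpace ℝ (Fin 2)) (hx : x ∈ fword [0, 0] '' S) (d : ℝ) (hd : 0 < d) :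
    closedBall x d ∩ (f 1 '' S ∪ f 2 '' S) ⊆
        closedBall (refl4 x) d ∩ (f 1 '' S ∪ f 2 '' S) ∧
      muS S (closedBall x d ∩ f 0 '' S) =
        muS S (closedBall (refl4 x) d ∩ f 0 '' S) := by
  constructor
  · rintro y ⟨hy, hyS⟩
    refine ⟨(dist_refl4_le ?_ ?_).trans hy, hyS⟩
    · obtain ⟨p, hp, rfl⟩ := hx
      have := le_one_of_mem hScomp hSinv hp
      simp only [fword, Function.comp_apply, id_eq, f_apply, v, pt_zero]
      linarith
    · rcases hyS with ⟨p, hp, rfl⟩ | ⟨p, hp, rfl⟩ <;>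
      · have := nonneg_of_mem hScomp hSinv hp
        simp only [f_apply, v, pt_zero]
        linarith
  · have hsub : f 0 '' S ⊆ S := image_subset_iff.2 fun p hp => f_mem hSinv 0 hp
    have hmeas (c : EuclideanSpace ℝ (Fin 2)) : MeasurableSet (closedBall c d ∩ f 0 '' S) :=
      measurableSet_closedBall.inter (hScomp.image (continuous_f 0)).measurableSet
    have himage : refl4 '' (closedBall x d ∩ f 0 '' S) = closedBall (refl4 x) d ∩ f 0 '' S := by
      rw [refl4_involutive.image_eq_preimage_symm, preimage_inter,
        refl4_preimage_f_zero_image hScomp hSinv, ← isometry_refl4.preimage_closedBall (refl4 x) d,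
        refl4_involutive]
    rw [muS_apply_of_subset (hmeas _) (inter_subset_right.trans hsub),
      muS_apply_of_subset (hmeas _) (inter_subset_right.trans hsub), ← himage,
      isometry_refl4.hausdorffMeasure_image (Or.inr refl4_involutive.surjective)]

end
end
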